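/- Let r be a natural number and K : ℝ → ℝ an integrable, compactly supported function satisfying the moment conditions ∫_ℝ K(z) dz = 1 and ∫_ℝ K(z) z^j dz = 0 for all integers j with 1 ≤ j ≤ r. Let f : ℝ → ℝ be (r+1)-times continuously differentiable with |f^{(r+1)}(x)| ≤ M for all x ∈ ℝ. For h > 0, set K_h(z) := h^{−1} K(z/h) and define the convolution (K_h ⋆ f)(x) := ∫_ℝ K_h(x − y) f(y) dy. Then for every x ∈ ℝ, |f(x) − (K_h ⋆ f)(x)| ≤ (M / (r+1)!) · (∫_ℝ |K(z)| · |z|^{r+1} dz) · h^{r+1}. -/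

import Mathlib

open MeasureTheory

/-- Taylor's theorem on the line, centred at `x`, with a uniform bound on the last derivative. -/
theorem abs_sub_taylor_sum_le {r : ℕ} {f : ℝ → ℝ} (hf : ContDiff ℝ (↑(r + 1)) f) {M : ℝ}
    (hM : ∀ x : ℝ, |iteratedDeriv (r + 1) f x| ≤ M) (x y : ℝ) :
    |f y - ∑ k ∈ Finset.range (r + 1), iteratedDeriv k f x / k.factorial * (y - x) ^ k|
      ≤ M / (r + 1).factorial * |y - x| ^ (r + 1) := by
  rcases eq_or_ne x y with rfl | hxy
  · simp [Finset.sum_range_succ']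
  obtain ⟨c, -, hc⟩ := taylor_mean_remainder_lagrange_iteratedDeriv (n := r) hxy
    (by exact_mod_cast hf.contDiffOn)
  have hsum : taylorWithinEval f r (Set.uIcc x y) x y =
      ∑ k ∈ Finset.range (r + 1), iteratedDeriv k f x / k.factorial * (y - x) ^ k := by
    rw [taylor_within_apply]
    refine Finset.sum_congr rfl fun k hk => ?_
    have hk' : k ≤ r + 1 := (Finset.mem_range.mp hk).le
    rw [iteratedDerivWithin_eq_iteratedDeriv (uniqueDiffOn_uIcc hxy)
      (hf.of_le (by exact_mod_cast hk')).contDiffAt Set.left_mem_uIcc, smul_eq_mul]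
    ring
  rw [← hsum, hc, abs_div, abs_mul, abs_pow, Nat.abs_cast, div_mul_eq_mul_div]
  gcongr
  exact hM c

/-- An integrable compactly supported function times a continuous one is integrable. -/
theorem integrable_mul_continuous_of_hasCompactSupport {K g : ℝ → ℝ} (hK : Integrable K)
    (hKsupp : HasCompactSupport K) (hg : Continuous g) : Integrable fun z => K z * g z := by
  have hon : IntegrableOn (fun z => K z * g z) (tsupport K) :=
    hK.integrableOn.mul_continuousOn hg.continuousOn hKsupp
  refine (integrableOn_iff_integrable_of_support_subset ?_).mp hon
  exact (Function.support_mul_subset_left K g).trans (subset_tsupport K)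

/-- Rescaling the variable in a convolution with `h⁻¹ * K (· / h)`. -/
theorem integral_scaled_kernel_mul (K f : ℝ → ℝ) {h : ℝ} (hh : 0 < h) (x : ℝ) :
    ∫ y, (h⁻¹ * K ((x - y) / h)) * f y = ∫ z, K z * f (x - h * z) := by
  have h1 := integral_sub_left_eq_self (fun w => (h⁻¹ * K (w / h)) * f (x - w)) volume x
  have h2 := Measure.integral_comp_div (fun z => h⁻¹ * (K z * f (x - h * z))) h
  simp only [sub_sub_cancel] at h1
  rw [h1]
  simp only [mul_div_cancel₀ _ hh.ne', integral_const_mul, smul_eq_mul, abs_of_pos hh,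
    mul_inv_cancel_left₀ hh.ne'] at h2
  simpa only [mul_assoc, integral_const_mul] using h2

/-- A kernel with `r` vanishing moments and unit mass reproduces polynomials of degree `r`. -/
theorem integral_kernel_mul_sum {r : ℕ} {K : ℝ → ℝ} (hKint : Integrable K)
    (hKsupp : HasCompactSupport K) (hK0 : ∫ z, K z = 1)
    (hKmom : ∀ j : ℕ, 1 ≤ j → j ≤ r → ∫ z, K z * z ^ j = 0) (a : ℕ → ℝ) :
    ∫ z, K z * ∑ k ∈ Finset.range (r + 1), a k * z ^ k = a 0 := by
  have hterm (k : ℕ) : Integrable fun z => a k * (K z * z ^ k) :=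
    (integrable_mul_continuous_of_hasCompactSupport hKint hKsupp (continuous_pow k)).const_mul _
  simp_rw [Finset.mul_sum, mul_left_comm (K _)]
  rw [integral_finsetSum _ fun k _ => hterm k, Finset.sum_range_succ', Finset.sum_eq_zero]
  · simp [integral_const_mul, hK0]
  · intro k hk
    rw [integral_const_mul, hKmom (k + 1) (by lia) (by simpa using hk), mul_zero]

/-- Kernel-approximation estimate for a convolution filter satisfying `r` moment
conditions: if `∫ K = 1`, `∫ K(z) zʲ dz = 0` for `1 ≤ j ≤ r`, and `f` is `(r+1)`-times
continuously differentiable with `|f^{(r+1)}| ≤ M`, then the scaled convolution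
`K_h ⋆ f` approximates `f` to order `h^{r+1}`. -/
theorem stmt_9 (r : ℕ) (K : ℝ → ℝ) (hKint : Integrable K) (hKsupp : HasCompactSupport K)
    (hK0 : ∫ z, K z = 1)
    (hKmom : ∀ j : ℕ, 1 ≤ j → j ≤ r → ∫ z, K z * z ^ j = 0)
    (f : ℝ → ℝ) (hf : ContDiff ℝ (↑(r + 1)) f) (M : ℝ)
    (hM : ∀ x : ℝ, |iteratedDeriv (r + 1) f x| ≤ M)
    (h : ℝ) (hh : 0 < h) :
    ∀ x : ℝ, |f x - ∫ y, (h⁻¹ * K ((x - y) / h)) * f y|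
      ≤ (M / (Nat.factorial (r + 1))) * (∫ z, |K z| * |z| ^ (r + 1)) * h ^ (r + 1) := by
  intro x
  set P : ℝ → ℝ := fun z =>
    ∑ k ∈ Finset.range (r + 1), iteratedDeriv k f x / k.factorial * (-h) ^ k * z ^ k with hP
  have hPc : Continuous P := by fun_prop
  have hfc : Continuous fun z => f (x - h * z) := hf.continuous.comp (by fun_prop)
  have hPint : ∫ z, K z * P z = f x := by
    rw [hP, integral_kernel_mul_sum hKint hKsupp hK0 hKmom]
    simp
  have hbound (z : ℝ) : ‖K z * P z - K z * f (x - h * z)‖ ≤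
      M / (r + 1).factorial * h ^ (r + 1) * (|K z| * |z| ^ (r + 1)) := by
    have ht := abs_sub_taylor_sum_le hf hM x (x - h * z)
    have hshift : x - h * z - x = -h * z := by ring
    simp only [hshift, mul_pow (-h) z, ← mul_assoc] at ht
    rw [abs_mul, abs_neg, abs_of_pos hh, mul_pow] at ht
    rw [← mul_sub, norm_mul, Real.norm_eq_abs, Real.norm_eq_abs, abs_sub_comm]
    calc |K z| * |f (x - h * z) - P z|
        ≤ |K z| * (M / (r + 1).factorial * (h ^ (r + 1) * |z| ^ (r + 1))) := by gcongr
      _ = _ := by ring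
  have habs : Integrable fun z => |K z| * |z| ^ (r + 1) :=
    integrable_mul_continuous_of_hasCompactSupport hKint.abs
      (hKsupp.comp_left abs_zero) (by fun_prop)
  rw [integral_scaled_kernel_mul K f hh, ← hPint, ← integral_sub
    (integrable_mul_continuous_of_hasCompactSupport hKint hKsupp hPc)
    (integrable_mul_continuous_of_hasCompactSupport hKint hKsupp hfc)]
  refine (norm_integral_le_of_norm_le (habs.const_mul _) (.of_forall hbound)).trans_eq ?_
  rw [integral_const_mul]
  ring
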